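/- arXiv:1101.5110 — 2 statements merged into one kernel-verified Lean document; each statement's English description precedes it below -/
import Mathlib

section
/- Let H be a graph on the vertex set {1,…,h} that is connected and has no bridges, and let G be a graph on the vertex set {1,…,n} with n > h. If H appears at W_1 in G and H appears at W_2 in G with W_1 ≠ W_2, then W_1 and W_2 are disjoint. -/
/-- `Appears H G W` says that the graph `H` (on vertex set `Fin h`) *appears* at the
vertex set `W` in the graph `G` (on vertex set `Fin n`): (a) `W` has `h` elements and
the increasing bijection from `Fin h` to `W` is an isomorphism between `H` and the
induced subgraph `G[W]`; (b) there is exactly one edge of `G` between `W` and the rest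
of `G`, and this edge is incident with the root `r_W`, the least element of `W`. -/
def Appears {h n : ℕ} (H : SimpleGraph (Fin h)) (G : SimpleGraph (Fin n))
    (W : Finset (Fin n)) : Prop :=
  ∃ hc : W.card = h,
    (∀ i j : Fin h,
        H.Adj i j ↔ G.Adj (W.orderIsoOfFin hc i) (W.orderIsoOfFin hc j)) ∧
    (∃! p : Fin n × Fin n, p.1 ∈ W ∧ p.2 ∉ W ∧ G.Adj p.1 p.2) ∧
    (∀ u v : Fin n, u ∈ W → v ∉ W → G.Adj u v → ∀ w ∈ W, u ≤ w)

/-- In a connected graph without bridges, at least two edges leave any nonempty proper set of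
vertices. -/
theorem SimpleGraph.Connected.exists_two_boundary_edges {V : Type*} {H : SimpleGraph V}
    (hH : H.Connected) (hbr : ∀ e : Sym2 V, ¬ H.IsBridge e) {S : Set V} {x y : V}
    (hx : x ∈ S) (hy : y ∉ S) :
    ∃ a b c d : V, a ∈ S ∧ b ∉ S ∧ H.Adj a b ∧ c ∈ S ∧ d ∉ S ∧ H.Adj c d ∧ (a, b) ≠ (c, d) := by
  obtain ⟨p⟩ := hH.preconnected x y
  obtain ⟨⟨⟨a, b⟩, hab⟩, -, ha, hb⟩ := p.exists_boundary_dart S hx hy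
  have hreach : (H.deleteEdges {s(a, b)}).Reachable a b := by
    by_contra hr
    exact hbr s(a, b) (SimpleGraph.isBridge_iff.2 hr)
  obtain ⟨q⟩ := hreach
  obtain ⟨⟨⟨c, d⟩, hcd⟩, -, hc, hd⟩ := q.exists_boundary_dart S ha hb
  rw [SimpleGraph.deleteEdges_adj] at hcd
  refine ⟨a, b, c, d, ha, hb, hab, hc, hd, hcd.1, fun heq => hcd.2 ?_⟩
  obtain ⟨rfl, rfl⟩ := Prod.mk.inj heq
  exact Set.mem_singleton _

/-- If `H` is connected with no bridges and `H` appears at two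
distinct sets `W₁ ≠ W₂` in `G`, then `W₁` and `W₂` are disjoint. -/
theorem appearances_disjoint {h n : ℕ} (H : SimpleGraph (Fin h)) (G : SimpleGraph (Fin n))
    (hH : H.Connected) (hbr : ∀ e : Sym2 (Fin h), ¬ H.IsBridge e) (hn : h < n)
    (W₁ W₂ : Finset (Fin n)) (h₁ : Appears H G W₁) (h₂ : Appears H G W₂)
    (hne : W₁ ≠ W₂) : Disjoint W₁ W₂ := by
  obtain ⟨hc₁, hiso, -, -⟩ := h₁
  obtain ⟨hc₂, -, hunique, -⟩ := h₂
  rw [Finset.disjoint_left]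
  intro w hw₁ hw₂
  have hsub : ¬ W₁ ⊆ W₂ := fun hs => hne (Finset.eq_of_subset_of_card_le hs (by rw [hc₁, hc₂]))
  obtain ⟨z, hz₁, hz₂⟩ := Finset.not_subset.1 hsub
  let f := W₁.orderIsoOfFin hc₁
  obtain ⟨a, b, c, d, ha, hb, hab, hc, hd, hcd, hdist⟩ :=
    hH.exists_two_boundary_edges hbr (S := {i | (f i : Fin n) ∈ W₂})
      (x := f.symm ⟨w, hw₁⟩) (y := f.symm ⟨z, hz₁⟩)
      (by simpa using hw₂) (by simpa using hz₂)
  have heq := hunique.unique (y₁ := ((f a : Fin n), (f b : Fin n)))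
    (y₂ := ((f c : Fin n), (f d : Fin n)))
    ⟨ha, hb, (hiso a b).1 hab⟩ ⟨hc, hd, (hiso c d).1 hcd⟩
  obtain ⟨hac, hbd⟩ := Prod.mk.inj heq
  exact hdist (Prod.ext (f.injective (Subtype.ext hac)) (f.injective (Subtype.ext hbd)))
end

section
/- Let H be a connected graph on the vertex set {1,…,h} and let G be a graph on the vertex set {1,…,n} with n > h. For every set W at which H appears in G, the number of sets W' ≠ W at which H appears in G and which share at least one vertex with W is at most h − 1. -/
/-- A vertex set at which a connected graph appears has an edge across each of its
nontrivial cuts. -/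
theorem Appears.exists_adj_of_mem_of_notMem {h n : ℕ} {H : SimpleGraph (Fin h)}
    {G : SimpleGraph (Fin n)} {W : Finset (Fin n)} (hW : Appears H G W) (hH : H.Connected)
    (S : Finset (Fin n)) {a b : Fin n} (haW : a ∈ W) (haS : a ∈ S) (hbW : b ∈ W) (hbS : b ∉ S) :
    ∃ u v, u ∈ W ∧ u ∈ S ∧ v ∈ W ∧ v ∉ S ∧ G.Adj u v := by
  obtain ⟨hc, hiso, -⟩ := hW
  let e := W.orderIsoOfFin hc
  obtain ⟨p⟩ := hH.preconnected (e.symm ⟨a, haW⟩) (e.symm ⟨b, hbW⟩)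
  obtain ⟨d, -, hd₁, hd₂⟩ := p.exists_boundary_dart {i | (e i : Fin n) ∈ S}
    (by simpa using haS) (by simpa using hbS)
  exact ⟨e d.fst, e d.snd, (e d.fst).2, hd₁, (e d.snd).2, hd₂, (hiso _ _).1 d.adj⟩

/-- The unique edge leaving an appearance joins its least element to an outside vertex. -/
theorem Appears.exists_boundary_edge {h n : ℕ} {H : SimpleGraph (Fin h)}
    {G : SimpleGraph (Fin n)} {W : Finset (Fin n)} (hW : Appears H G W) :
    ∃ r s, r ∈ W ∧ s ∉ W ∧ (∀ w ∈ W, r ≤ w) ∧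
      ∀ u v, u ∈ W → v ∉ W → G.Adj u v → u = r ∧ v = s := by
  obtain ⟨-, -, ⟨⟨r, s⟩, ⟨hr, hs, hrs⟩, huniq⟩, hmin⟩ := hW
  exact ⟨r, s, hr, hs, hmin r s hr hs hrs,
    fun u v hu hv huv => Prod.ext_iff.1 (huniq (u, v) ⟨hu, hv, huv⟩)⟩

/-- Suppose that every edge leaving `W` joins `r` to `s`. Then every appearance of a connected
graph of the same size which meets `W` and differs from it contains both `r` and `s`. -/
theorem Appears.mem_of_meets {h n : ℕ} {H : SimpleGraph (Fin h)} {G : SimpleGraph (Fin n)}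
    {W W' : Finset (Fin n)} (hW' : Appears H G W') (hH : H.Connected) (hcard : W.card = h)
    (hne : W' ≠ W) (hmeet : ¬ Disjoint W' W) {r s : Fin n}
    (hrs : ∀ u v, u ∈ W → v ∉ W → G.Adj u v → u = r ∧ v = s) :
    r ∈ W' ∧ s ∈ W' := by
  obtain ⟨a, haW', haW⟩ := Finset.not_disjoint_iff.1 hmeet
  have hsub : ¬ W' ⊆ W := fun hsub =>
    hne (Finset.eq_of_subset_of_card_le hsub (hcard.trans hW'.1.symm).le)
  obtain ⟨b, hbW', hbW⟩ := Finset.not_subset.1 hsub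
  obtain ⟨u, v, huW', huW, hvW', hvW, huv⟩ :=
    hW'.exists_adj_of_mem_of_notMem hH W haW' haW hbW' hbW
  obtain ⟨rfl, rfl⟩ := hrs u v huW hvW huv
  exact ⟨huW', hvW'⟩

/-- If `H` is connected and `H` appears at `W` in `G`, then the number
of sets `W' ≠ W` at which `H` appears in `G` and which share at least one vertex with
`W` is at most `h - 1`. -/
theorem appearances_meeting_le {h n : ℕ} (H : SimpleGraph (Fin h)) (G : SimpleGraph (Fin n))
    (hH : H.Connected) (hn : h < n)
    (W : Finset (Fin n)) (hW : Appears H G W) :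
    Set.ncard {W' : Finset (Fin n) | Appears H G W' ∧ W' ≠ W ∧ ¬ Disjoint W' W} ≤
      h - 1 := by
  obtain ⟨r, s, hrW, -, hmin, hrs⟩ := hW.exists_boundary_edge
  have key : ∀ W', Appears H G W' ∧ W' ≠ W ∧ ¬ Disjoint W' W →
      ∃ t, t ∈ W.erase r ∧ r ∈ W' ∧ t ∉ W' ∧
        ∀ u v, u ∈ W' → v ∉ W' → G.Adj u v → u = r ∧ v = t := by
    rintro W' ⟨hW', hne, hmeet⟩
    obtain ⟨r', t, hr'W', htW', hmin', hrt⟩ := hW'.exists_boundary_edge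
    obtain ⟨hrW', -⟩ := hW'.mem_of_meets hH hW.1 hne hmeet hrs
    obtain ⟨hr'W, htW⟩ := hW.mem_of_meets hH hW'.1 hne.symm (fun hd => hmeet hd.symm) hrt
    obtain rfl : r' = r := le_antisymm (hmin' r hrW') (hmin r' hr'W)
    exact ⟨t, Finset.mem_erase.2 ⟨fun heq => htW' (heq ▸ hrW'), htW⟩, hrW', htW', hrt⟩
  have : Nonempty (Fin n) := ⟨r⟩
  choose! f hf using key
  calc Set.ncard {W' : Finset (Fin n) | Appears H G W' ∧ W' ≠ W ∧ ¬ Disjoint W' W}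
      ≤ Set.ncard (W.erase r : Set (Fin n)) := by
        refine Set.ncard_le_ncard_of_injOn f (fun W' hW' => (hf W' hW').1) ?_
          (Finset.finite_toSet _)
        intro W₁ h₁ W₂ h₂ heq
        by_contra hne
        obtain ⟨-, hr₁, -, hedge₁⟩ := hf W₁ h₁
        obtain ⟨-, hr₂, hf₂, -⟩ := hf W₂ h₂
        have hmem := h₂.1.mem_of_meets hH h₁.1.1 (Ne.symm hne)
          (Finset.not_disjoint_iff.2 ⟨r, hr₂, hr₁⟩) hedge₁
        exact hf₂ (heq ▸ hmem.2)
    _ = h - 1 := by rw [Set.ncard_coe_finset, Finset.card_erase_of_mem hrW, hW.1]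
end
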